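/- arXiv:1411.1778 — 7 statements merged into one kernel-verified Lean document; each statement's English description precedes it below -/
import Mathlib

section
/- Let (B, C) be a basic pair in V, i.e., B and C are disjoint finite sets of nonzero vectors of V, B is a basis of V, and there exists a linear order on S = B ∪ C with respect to which both B and C are nbc in S. Then S = B ∪ C is balanced: S spans V and every nonempty closed subset S' ⊆ S satisfies |S'| < 2·dim(span S'). -/
/-!
Context: `V` is a finite-dimensional complex vector space.
For a finite set `S` of nonzero vectors of `V`, a subset `S' ⊆ S` is closed in `S`
if `S' = S ∩ span S'`.  `S` is balanced if `S` spans `V` and every nonempty closed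
subset `S' ⊆ S` satisfies `|S'| < 2 · dim (span S')`.
Given a linear order on `S` (encoded by a function `f : V → ℕ` injective on `S`),
a circuit of `S` is a minimal linearly dependent subset of `S`, a broken circuit is
`K \ {min K}` for a circuit `K`, and `T ⊆ S` is nbc if `T` contains no broken circuit.
A pair `(B, C)` of disjoint finite sets of nonzero vectors is basic if `B` is a basis
of `V` and there is a linear order on `B ∪ C` for which both `B` and `C` are nbc.
-/

open Module Submodule

variable {V : Type*} [AddCommGroup V] [Module ℂ V]

/-- A finite set of vectors is linearly independent. -/
def LinIndepF (T : Finset V) : Prop :=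
  LinearIndependent ℂ (fun v : {x : V // x ∈ T} => (v : V))

/-- `K` is a circuit of `S` : a minimal linearly dependent subset of `S`. -/
def IsCircuit (S K : Finset V) : Prop :=
  K ⊆ S ∧ ¬ LinIndepF K ∧ ∀ K' : Finset V, K' ⊂ K → LinIndepF K'

/-- `x` is the minimum of `K` with respect to the linear order encoded by `f`. -/
def IsMinOf (f : V → ℕ) (x : V) (K : Finset V) : Prop :=
  x ∈ K ∧ ∀ y ∈ K, f x ≤ f y

/-- `T ⊆ S` is nbc in `S` with respect to the linear order encoded by `f` :
`T` contains no broken circuit `K \ {min K}` of a circuit `K` of `S`. -/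
def IsNBC [DecidableEq V] (f : V → ℕ) (S T : Finset V) : Prop :=
  T ⊆ S ∧ ∀ K : Finset V, ∀ x : V, IsCircuit S K → IsMinOf f x K → ¬ K.erase x ⊆ T

/-- `S'` is a closed subset of `S` : `S' = S ∩ span S'`. -/
def IsClosedIn (S S' : Finset V) : Prop :=
  S' ⊆ S ∧ ∀ v ∈ S, v ∈ span ℂ (S' : Set V) → v ∈ S'

/-- `S` is balanced : `S` spans `V` and every nonempty closed subset `S' ⊆ S`
satisfies `|S'| < 2 · dim (span S')`. -/
def IsBalanced (S : Finset V) : Prop :=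
  span ℂ (S : Set V) = ⊤ ∧
    ∀ S' : Finset V, IsClosedIn S S' → S'.Nonempty →
      S'.card < 2 * finrank ℂ (span ℂ (S' : Set V))

/-- `(B, C)` is a basic pair : `B` and `C` are disjoint finite sets of nonzero
vectors, `B` is a basis of `V`, and there is a linear order on `B ∪ C` for which
both `B` and `C` are nbc in `B ∪ C`. -/
def IsBasicPair [DecidableEq V] (B C : Finset V) : Prop :=
  Disjoint B C ∧ (0 : V) ∉ B ∪ C ∧
    LinIndepF B ∧ span ℂ (B : Set V) = ⊤ ∧
    ∃ f : V → ℕ, Set.InjOn f ((B ∪ C : Finset V) : Set V) ∧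
      IsNBC f (B ∪ C) B ∧ IsNBC f (B ∪ C) C

theorem exists_isCircuit_subset {S T : Finset V} (hTS : T ⊆ S) (hT : ¬ LinIndepF T) :
    ∃ K ⊆ T, IsCircuit S K := by
  obtain ⟨K, hKT, hK⟩ := exists_minimal_le_of_wellFoundedLT (fun K => ¬ LinIndepF K) T hT
  exact ⟨K, hKT, hKT.trans hTS, hK.prop, fun K' hK' => by
    by_contra hdep
    exact hK.not_lt hdep hK'⟩

/-- Adjoining to a subset of an nbc set an element lying below all of it preserves linear
independence. -/
theorem IsNBC.linIndepF_insert [DecidableEq V] {f : V → ℕ} {S T T' : Finset V} {m : V}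
    (hT : IsNBC f S T) (hT' : T' ⊆ T) (hm : m ∈ S) (hmin : ∀ y ∈ T', f m ≤ f y) :
    LinIndepF (insert m T') := by
  by_contra hdep
  obtain ⟨K, hK, hcirc⟩ :=
    exists_isCircuit_subset (Finset.insert_subset hm (hT'.trans hT.1)) hdep
  by_cases hmK : m ∈ K
  · refine hT.2 K m hcirc ⟨hmK, fun y hy => ?_⟩
      ((Finset.subset_insert_iff.1 hK).trans hT')
    rcases Finset.mem_insert.1 (hK hy) with rfl | hy'
    exacts [le_rfl, hmin y hy']
  · have hne : K.Nonempty := by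
      rw [Finset.nonempty_iff_ne_empty]
      rintro rfl
      exact hcirc.2.1 linearIndependent_empty_type
    obtain ⟨x, hx, hxmin⟩ := K.exists_min_image f hne
    exact hT.2 K x hcirc ⟨hx, hxmin⟩
      ((K.erase_subset x).trans (((Finset.subset_insert_iff_of_notMem hmK).1 hK).trans hT'))

theorem LinIndepF.card_le_finrank_span [FiniteDimensional ℂ V] {T S : Finset V}
    (hT : LinIndepF T) (hTS : T ⊆ S) :
    T.card ≤ finrank ℂ (span ℂ (S : Set V)) := by
  rw [← finrank_span_finset_eq_card hT]
  exact Submodule.finrank_mono (span_mono (Finset.coe_subset.2 hTS))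

/-- If `(B, C)` is a basic pair then `B ∪ C` is balanced. -/
theorem basicPair_union_isBalanced [DecidableEq V] [FiniteDimensional ℂ V]
    (B C : Finset V) (h : IsBasicPair B C) :
    IsBalanced (B ∪ C) := by
  obtain ⟨-, -, -, hspan, f, -, hB, hC⟩ := h
  refine ⟨top_unique (hspan ▸ span_mono (Finset.coe_subset.2 Finset.subset_union_left)),
    fun S' hS' hne => ?_⟩
  obtain ⟨m, hm, hmin⟩ := S'.exists_min_image f hne
  have hcard : ∀ T, IsNBC f (B ∪ C) T →
      (insert m (T ∩ S')).card ≤ finrank ℂ (span ℂ (S' : Set V)) := fun T hT =>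
    (hT.linIndepF_insert Finset.inter_subset_left (hS'.1 hm) fun y hy =>
      hmin y (Finset.mem_inter.1 hy).2).card_le_finrank_span
        (Finset.insert_subset hm Finset.inter_subset_right)
  have hunion : insert m (B ∩ S') ∪ insert m (C ∩ S') = S' := by
    rw [← Finset.insert_union_distrib, ← Finset.union_inter_distrib_right,
      Finset.inter_eq_right.2 hS'.1, Finset.insert_eq_of_mem hm]
  have hinter : 0 < (insert m (B ∩ S') ∩ insert m (C ∩ S')).card :=
    Finset.card_pos.2 ⟨m, by simp⟩
  have hsum := Finset.card_union_add_card_inter (insert m (B ∩ S')) (insert m (C ∩ S'))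
  rw [hunion] at hsum
  have := hcard B hB
  have := hcard C hC
  omega
end

section
/- Let S be a balanced finite set of nonzero vectors of V. Then there exist disjoint subsets B and C with S = B ∪ C such that B is a basis of V and there exists a linear order on S with respect to which both B and C are nbc in S; in other words, every balanced set is S = B ∪ C for some basic pair (B, C). -/
open Module Submodule

variable {V : Type*} [AddCommGroup V] [Module ℂ V]

section IndependentPartition

variable {𝕜 W : Type*} [Field 𝕜] [AddCommGroup W] [Module 𝕜 W]

/-- The decreasing sequence `U₀ = ⊤`, `Uₙ₊₁ = span (B ∩ Uₙ) ⊓ span (C ∩ Uₙ)`. -/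
def spanSeq (𝕜 : Type*) {W : Type*} [Field 𝕜] [AddCommGroup W] [Module 𝕜 W]
    (B C : Set W) : ℕ → Submodule 𝕜 W
  | 0 => ⊤
  | n + 1 => span 𝕜 (B ∩ spanSeq 𝕜 B C n) ⊓ span 𝕜 (C ∩ spanSeq 𝕜 B C n)

lemma spanSeq_comm (B C : Set W) (n : ℕ) : spanSeq 𝕜 B C n = spanSeq 𝕜 C B n := by
  induction n with
  | zero => rfl
  | succ n ih => simp only [spanSeq, ih, inf_comm]

lemma spanSeq_antitone (B C : Set W) : Antitone (spanSeq 𝕜 B C) :=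
  antitone_nat_of_succ_le fun _ =>
    inf_le_left.trans (span_le.2 Set.inter_subset_right)

lemma spanSeq_le_of_subset_span {B B' C : Set W} {n : ℕ}
    (h : ∀ k < n, B' ∩ spanSeq 𝕜 B C k ⊆ span 𝕜 (B ∩ spanSeq 𝕜 B C k)) :
    spanSeq 𝕜 B' C n ≤ spanSeq 𝕜 B C n := by
  induction n with
  | zero => exact le_rfl
  | succ n ih =>
    have hn := ih fun k hk => h k (hk.trans n.lt_succ_self)
    refine inf_le_inf ?_ (span_mono (Set.inter_subset_inter_right _ hn))
    exact (span_mono (Set.inter_subset_inter_right _ hn)).trans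
      (span_le.2 (h n n.lt_succ_self))

lemma LinearIndepOn.notMem_span_sdiff {B : Set W} (hB : LinearIndepOn 𝕜 id B) {b : W}
    (hb : b ∈ B) : b ∉ span 𝕜 (B \ {b}) := by
  simpa using linearIndepOn_iff_notMem_span.1 hB b hb

/-- If `x` lies in the span of the part of an independent set `B` inside `P`, but not in the span
of the part inside `Q`, then `x` can replace an element of `B` that lies outside `Q`. -/
lemma exists_linearIndepOn_exchange {B P Q : Set W} {x : W} (hB : LinearIndepOn 𝕜 id B)
    (hP : x ∈ span 𝕜 (B ∩ P)) (hQ : x ∉ span 𝕜 (B ∩ Q)) :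
    ∃ b ∈ B, b ∉ Q ∧ LinearIndepOn 𝕜 id (insert x (B \ {b})) := by
  classical
  obtain ⟨T₀, hT₀, hxT₀⟩ := mem_span_finite_of_mem_span hP
  obtain ⟨T, hTle, hT⟩ := exists_minimal_le_of_wellFoundedLT
    (fun T : Finset W => x ∈ span 𝕜 (T : Set W)) T₀ hxT₀
  have hTB : ∀ t ∈ T, t ∈ B := fun t ht => (hT₀ (hTle ht)).1
  obtain ⟨b, hbT, hbQ⟩ : ∃ b ∈ T, b ∉ Q := by
    by_contra! hcon
    have hTQ : (T : Set W) ⊆ B ∩ Q := fun t ht => ⟨hTB t ht, hcon t ht⟩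
    exact hQ (span_mono hTQ hT.prop)
  refine ⟨b, hTB b hbT, hbQ, (hB.mono Set.sdiff_subset).id_insert fun hx => ?_⟩
  have hxT : x ∈ span 𝕜 (insert b ((T.erase b : Finset W) : Set W)) := by
    rw [← Finset.coe_insert, Finset.insert_erase hbT]
    exact hT.prop
  have hb := mem_span_insert_exchange hxT
    (hT.not_prop_of_lt (Finset.erase_ssubset hbT))
  refine hB.notMem_span_sdiff (hTB b hbT) (span_le.2 (Set.insert_subset hx ?_) hb)
  exact fun t ht => subset_span ⟨hTB t (Finset.mem_of_mem_erase ht), Finset.ne_of_mem_erase ht⟩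

/-- One augmentation step of the matroid partition algorithm. -/
lemma exists_partition_insert [DecidableEq W] (n : ℕ) : ∀ (B C : Finset W) (x : W),
    LinearIndepOn 𝕜 id (B : Set W) → LinearIndepOn 𝕜 id (C : Set W) → Disjoint B C →
    x ∉ B ∪ C → x ∉ spanSeq 𝕜 (B : Set W) C n →
    ∃ B' C' : Finset W, Disjoint B' C' ∧ B' ∪ C' = insert x (B ∪ C) ∧
      LinearIndepOn 𝕜 id (B' : Set W) ∧ LinearIndepOn 𝕜 id (C' : Set W) := by
  induction n with
  | zero => intro B C x _ _ _ _ hx; exact absurd mem_top hx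
  | succ n ih =>
    have key : ∀ (B C : Finset W) (x : W),
        LinearIndepOn 𝕜 id (B : Set W) → LinearIndepOn 𝕜 id (C : Set W) → Disjoint B C →
        x ∉ B ∪ C → x ∈ spanSeq 𝕜 (B : Set W) C n →
        x ∉ span 𝕜 ((B : Set W) ∩ spanSeq 𝕜 (B : Set W) C n) →
        ∃ B' C' : Finset W, Disjoint B' C' ∧ B' ∪ C' = insert x (B ∪ C) ∧
          LinearIndepOn 𝕜 id (B' : Set W) ∧ LinearIndepOn 𝕜 id (C' : Set W) := by
      intro B C x hB hC hBC hx hxn hxB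
      rw [Finset.mem_union, not_or] at hx
      cases n with
      | zero =>
        refine ⟨insert x B, C, ?_, Finset.insert_union _ _ _, ?_, hC⟩
        · exact Finset.disjoint_insert_left.2 ⟨hx.2, hBC⟩
        · rw [Finset.coe_insert]
          exact hB.id_insert (by simpa [spanSeq] using hxB)
      | succ m =>
        obtain ⟨b, hbB, hbn, hind⟩ := exists_linearIndepOn_exchange hB hxn.1 hxB
        have hbC : b ∉ C := Finset.disjoint_left.1 hBC hbB
        have hbx : b ≠ x := fun h => hx.1 (h ▸ hbB)
        have hle : spanSeq 𝕜 ((insert x (B.erase b) : Finset W) : Set W) C (m + 1) ≤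
            spanSeq 𝕜 (B : Set W) C (m + 1) := by
          refine spanSeq_le_of_subset_span fun k hk => ?_
          rintro y ⟨hy, hyk⟩
          rw [Finset.mem_coe, Finset.mem_insert, Finset.mem_erase] at hy
          rcases hy with rfl | hy
          · exact (spanSeq_antitone (𝕜 := 𝕜) (B : Set W) C (Nat.succ_le_of_lt hk) hxn).1
          · exact subset_span ⟨hy.2, hyk⟩
        obtain ⟨B', C', hd, hu, hB', hC'⟩ := ih (insert x (B.erase b)) C b
          (by simpa using hind) hC
          (Finset.disjoint_insert_left.2 ⟨hx.2, hBC.mono_left (B.erase_subset b)⟩)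
          (by simp [hbx, hbC]) (fun hb => hbn (hle hb))
        refine ⟨B', C', hd, hu.trans ?_, hB', hC'⟩
        ext y
        grind
    intro B C x hB hC hBC hx hxn
    by_cases hxn' : x ∈ spanSeq 𝕜 (B : Set W) C n
    · rcases not_and_or.1 hxn with h | h
      · exact key B C x hB hC hBC hx hxn' h
      · have hs := spanSeq_comm (𝕜 := 𝕜) (B : Set W) C n
        obtain ⟨B', C', hd, hu, hB', hC'⟩ := key C B x hC hB hBC.symm
          (by rwa [Finset.union_comm]) (hs ▸ hxn') (hs ▸ h)
        exact ⟨B', C', hd, by rw [hu, Finset.union_comm C B], hB', hC'⟩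
    · exact ih B C x hB hC hBC hx hxn'

/-- The stable value `U` of `spanSeq` is spanned both by `B ∩ U` and by `C ∩ U`, so the counting
condition on subsets of `insert x (B ∪ C)` keeps `x` out of it. -/
lemma exists_notMem_spanSeq [DecidableEq W] [FiniteDimensional 𝕜 W] {B C : Finset W} {x : W}
    (hB : LinearIndepOn 𝕜 id (B : Set W)) (hC : LinearIndepOn 𝕜 id (C : Set W))
    (hBC : Disjoint B C)
    (h : ∀ A ⊆ insert x (B ∪ C), A.Nonempty → A.card < 2 * finrank 𝕜 (span 𝕜 (A : Set W))) :
    ∃ n, x ∉ spanSeq 𝕜 (B : Set W) C n := by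
  classical
  by_contra! hx
  obtain ⟨n, hn⟩ := IsArtinian.monotone_stabilizes
    (⟨_, (spanSeq_antitone (𝕜 := 𝕜) (B : Set W) C).dual_right⟩ : ℕ →o (Submodule 𝕜 W)ᵒᵈ)
  have hU : spanSeq 𝕜 (B : Set W) C n = spanSeq 𝕜 (B : Set W) C (n + 1) := hn (n + 1) n.le_succ
  set U := spanSeq 𝕜 (B : Set W) C n
  have hUinf : U = span 𝕜 ((B : Set W) ∩ U) ⊓ span 𝕜 ((C : Set W) ∩ U) := hU
  have hcard : ∀ T : Finset W, LinearIndepOn 𝕜 id (T : Set W) → U ≤ span 𝕜 ((T : Set W) ∩ U) →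
      (T.filter (· ∈ U)).card = finrank 𝕜 U := by
    intro T hT hle
    have hTU : ((T.filter (· ∈ U) : Finset W) : Set W) = (T : Set W) ∩ U := by
      ext; simp
    have hs : span 𝕜 ((T.filter (· ∈ U) : Finset W) : Set W) = U := by
      rw [hTU]; exact le_antisymm (span_le.2 Set.inter_subset_right) hle
    have hTfin : LinearIndepOn 𝕜 id ((T.filter (· ∈ U) : Finset W) : Set W) :=
      hT.mono (hTU ▸ Set.inter_subset_left)
    have hrank := finrank_span_finset_eq_card hTfin
    rw [hs] at hrank
    exact hrank.symm
  have h1 := hcard B hB (hUinf.le.trans inf_le_left)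
  have h2 := hcard C hC (hUinf.le.trans inf_le_right)
  have hlt := h ((insert x (B ∪ C)).filter (· ∈ U)) (Finset.filter_subset _ _)
    ⟨x, by simpa using hx n⟩
  have hle : finrank 𝕜 (span 𝕜 (((insert x (B ∪ C)).filter (· ∈ U) : Finset W) : Set W)) ≤
      finrank 𝕜 U := finrank_mono (span_le.2 fun y hy => (Finset.mem_filter.1 hy).2)
  have hge : ((B ∪ C).filter (· ∈ U)).card ≤ ((insert x (B ∪ C)).filter (· ∈ U)).card :=
    Finset.card_le_card (Finset.filter_subset_filter _ (Finset.subset_insert _ _))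
  rw [Finset.filter_union, Finset.card_union_of_disjoint
    (Finset.disjoint_filter_filter hBC)] at hge
  omega

/-- A finite set whose nonempty subsets `A` satisfy `|A| < 2 * dim (span A)` is a disjoint union
of two linearly independent sets. -/
lemma exists_linearIndepOn_partition [DecidableEq W] [FiniteDimensional 𝕜 W] (S : Finset W)
    (h : ∀ A ⊆ S, A.Nonempty → A.card < 2 * finrank 𝕜 (span 𝕜 (A : Set W))) :
    ∃ B C : Finset W, Disjoint B C ∧ B ∪ C = S ∧
      LinearIndepOn 𝕜 id (B : Set W) ∧ LinearIndepOn 𝕜 id (C : Set W) := by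
  induction S using Finset.induction_on with
  | empty => exact ⟨∅, ∅, by simp⟩
  | insert x S hx ih =>
    obtain ⟨B, C, hBC, rfl, hB, hC⟩ := ih fun A hA => h A (hA.trans (Finset.subset_insert _ _))
    obtain ⟨n, hn⟩ := exists_notMem_spanSeq hB hC hBC h
    exact exists_partition_insert n B C x hB hC hBC hx hn

/-- The first set of a partition into two independent sets can be enlarged to a basis of the
span of the union. -/
lemma exists_linearIndepOn_partition_span [DecidableEq W] {B C : Finset W}
    (hB : LinearIndepOn 𝕜 id (B : Set W)) (hC : LinearIndepOn 𝕜 id (C : Set W)) :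
    ∃ B' C' : Finset W, Disjoint B' C' ∧ B' ∪ C' = B ∪ C ∧
      LinearIndepOn 𝕜 id (B' : Set W) ∧ LinearIndepOn 𝕜 id (C' : Set W) ∧
      span 𝕜 (B' : Set W) = span 𝕜 ((B ∪ C : Finset W) : Set W) := by
  classical
  obtain ⟨D, hDs, hBD, hspan, hD⟩ := exists_linearIndepOn_id_extension hB
    (Finset.coe_subset.2 (Finset.subset_union_left (s₁ := B) (s₂ := C)))
  obtain ⟨D, rfl⟩ := ((B ∪ C).finite_toSet.subset hDs).exists_finset_coe
  rw [Finset.coe_subset] at hDs hBD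
  refine ⟨D, (B ∪ C) \ D, Finset.disjoint_sdiff, Finset.union_sdiff_of_subset hDs, hD,
    hC.mono fun y hy => ?_, le_antisymm (span_mono (Finset.coe_subset.2 hDs)) (span_le.2 hspan)⟩
  simp only [Finset.coe_sdiff, Set.mem_sdiff, Finset.mem_coe, Finset.mem_union] at hy
  exact hy.1.resolve_left fun h => hy.2 (hBD h)

/-- Two disjoint independent sets whose union has no nonempty subset `A` with
`2 * dim (span A) ≤ |A|` admit an order in which no element is in the span of the larger elements
of either set. -/
lemma exists_order_notMem_span [DecidableEq W] [FiniteDimensional 𝕜 W] (B C : Finset W)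
    (hB : LinearIndepOn 𝕜 id (B : Set W)) (hC : LinearIndepOn 𝕜 id (C : Set W))
    (hBC : Disjoint B C)
    (h : ∀ A ⊆ B ∪ C, A.Nonempty → A.card < 2 * finrank 𝕜 (span 𝕜 (A : Set W))) :
    ∃ f : W → ℕ, Set.InjOn f ((B ∪ C : Finset W) : Set W) ∧ ∀ x ∈ B ∪ C,
      x ∉ span 𝕜 {t | t ∈ B ∧ f x < f t} ∧ x ∉ span 𝕜 {t | t ∈ C ∧ f x < f t} := by
  induction hn : (B ∪ C).card generalizing B C with
  | zero =>
    rw [Finset.card_eq_zero] at hn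
    exact ⟨fun _ => 0, by simp [hn]⟩
  | succ n ih =>
    have key : ∃ x ∈ B ∪ C, x ∉ span 𝕜 ((B.erase x : Finset W) : Set W) ∧
        x ∉ span 𝕜 ((C.erase x : Finset W) : Set W) := by
      by_contra! hcon
      have hBle : span 𝕜 (B : Set W) ≤ span 𝕜 (C : Set W) := span_le.2 fun x hx => by
        have := hcon x (Finset.mem_union_left _ hx)
          (by simpa using hB.notMem_span_sdiff hx)
        exact span_mono (by simp) this
      have hCle : span 𝕜 (C : Set W) ≤ span 𝕜 (B : Set W) := span_le.2 fun x hx => by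
        by_contra hxB
        have := hcon x (Finset.mem_union_right _ hx) fun h' => hxB (span_mono (by simp) h')
        exact hC.notMem_span_sdiff hx (by simpa using this)
      have heq := le_antisymm hBle hCle
      have hlt := h _ subset_rfl (Finset.card_pos.1 (by omega))
      rw [Finset.coe_union, span_union, heq, sup_idem, Finset.card_union_of_disjoint hBC] at hlt
      have h1 : finrank 𝕜 (span 𝕜 (B : Set W)) = B.card := finrank_span_finset_eq_card hB
      have h2 : finrank 𝕜 (span 𝕜 (C : Set W)) = C.card := finrank_span_finset_eq_card hC
      rw [heq] at h1
      omega
    obtain ⟨x, hx, hxB, hxC⟩ := key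
    have hunion : B.erase x ∪ C.erase x = (B ∪ C).erase x := (Finset.erase_union_distrib ..).symm
    obtain ⟨f, hf, hfs⟩ := ih (B.erase x) (C.erase x) (hB.mono (by simp)) (hC.mono (by simp))
      (hBC.mono (B.erase_subset x) (C.erase_subset x))
      (fun A hA => h A (hA.trans (hunion ▸ Finset.erase_subset _ _)))
      (by rw [hunion, Finset.card_erase_of_mem hx, hn, Nat.add_sub_cancel])
    rw [hunion] at hf hfs
    refine ⟨fun v => if v = x then 0 else f v + 1, fun y hy z hz hyz => ?_, fun y hy => ?_⟩
    · by_cases hyx : y = x <;> by_cases hzx : z = x <;> simp [hyx, hzx] at hyz ⊢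
      exact hf (by simpa [hyx] using hy) (by simpa [hzx] using hz) hyz
    · by_cases hyx : y = x
      · subst hyx
        refine ⟨fun h' => hxB (span_mono ?_ h'), fun h' => hxC (span_mono ?_ h')⟩ <;>
        · rintro t ⟨ht, hlt⟩
          have : t ≠ y := by rintro rfl; simp at hlt
          simpa [this] using ht
      · obtain ⟨h1, h2⟩ := hfs y (by simpa [hyx] using hy)
        refine ⟨fun h' => h1 (span_mono ?_ h'), fun h' => h2 (span_mono ?_ h')⟩ <;>
        · rintro t ⟨ht, hlt⟩
          by_cases htx : t = x
          · simp [htx] at hlt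
          · simpa [hyx, htx, ht] using hlt

end IndependentPartition

lemma linIndepF_iff {T : Finset V} : LinIndepF T ↔ LinearIndepOn ℂ id (T : Set V) :=
  Iff.rfl

lemma IsBalanced.card_lt [FiniteDimensional ℂ V] {S : Finset V} (hS : IsBalanced S)
    {A : Finset V} (hA : A ⊆ S) (hne : A.Nonempty) :
    A.card < 2 * finrank ℂ (span ℂ (A : Set V)) := by
  classical
  set F := S.filter (· ∈ span ℂ (A : Set V))
  have hAF : A ⊆ F := fun a ha => Finset.mem_filter.2 ⟨hA ha, subset_span ha⟩
  have hspan : span ℂ (F : Set V) ≤ span ℂ (A : Set V) :=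
    span_le.2 fun y hy => (Finset.mem_filter.1 hy).2
  have hlt := hS.2 F ⟨Finset.filter_subset _ _, fun v hv hvF =>
    Finset.mem_filter.2 ⟨hv, hspan hvF⟩⟩ (hne.mono hAF)
  have := Finset.card_le_card hAF
  have := finrank_mono hspan
  omega

lemma IsCircuit.mem_span_erase [DecidableEq V] {S K : Finset V} (hK : IsCircuit S K) {x : V}
    (hx : x ∈ K) : x ∈ span ℂ ((K.erase x : Finset V) : Set V) := by
  by_contra hcon
  have hins := (linIndepF_iff.1 (hK.2.2 _ (Finset.erase_ssubset hx))).id_insert hcon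
  rw [← Finset.coe_insert, Finset.insert_erase hx] at hins
  exact hK.2.1 hins

lemma isNBC_of_notMem_span [DecidableEq V] {f : V → ℕ} {S T : Finset V} (hT : T ⊆ S)
    (hf : Set.InjOn f (S : Set V)) (h : ∀ x ∈ S, x ∉ span ℂ {t | t ∈ T ∧ f x < f t}) :
    IsNBC f S T := by
  refine ⟨hT, fun K x hK hx hKT => h x (hK.1 hx.1) ?_⟩
  refine span_mono ?_ (hK.mem_span_erase hx.1)
  intro t ht
  refine ⟨hKT ht, ?_⟩
  obtain ⟨htx, htK⟩ := Finset.mem_erase.1 ht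
  exact (hx.2 t htK).lt_of_ne fun he => htx (hf (hK.1 htK) (hK.1 hx.1) he.symm)

/-- Every balanced finite set `S` of nonzero vectors is the union
`B ∪ C` of a basic pair `(B, C)` : there are disjoint `B, C` with `S = B ∪ C`,
`B` a basis of `V`, and a linear order on `S` for which both `B` and `C` are nbc. -/
theorem isBalanced_eq_union_basicPair [DecidableEq V] [FiniteDimensional ℂ V]
    (S : Finset V) (h0 : (0 : V) ∉ S) (hS : IsBalanced S) :
    ∃ B C : Finset V, Disjoint B C ∧ B ∪ C = S ∧ IsBasicPair B C := by
  obtain ⟨B₀, C₀, -, hu₀, hB₀, hC₀⟩ :=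
    exists_linearIndepOn_partition (𝕜 := ℂ) S fun A hA hne => hS.card_lt hA hne
  obtain ⟨B, C, hBC, hu, hB, hC, hspan⟩ := exists_linearIndepOn_partition_span hB₀ hC₀
  rw [hu₀] at hu hspan
  subst hu
  obtain ⟨f, hf, hfs⟩ := exists_order_notMem_span B C hB hC hBC fun A hA hne => hS.card_lt hA hne
  exact ⟨B, C, hBC, rfl, hBC, h0, linIndepF_iff.2 hB, hspan.trans hS.1, f, hf,
    isNBC_of_notMem_span Finset.subset_union_left hf fun x hx => (hfs x hx).1,
    isNBC_of_notMem_span Finset.subset_union_right hf fun x hx => (hfs x hx).2⟩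
end

section
/- Let (B, C) be a well-balanced pair in V. Then every nonempty subset D ⊆ B ∪ C satisfies |D| < 2·dim(span D); in particular, the set B ∪ C is balanced. -/
open Module Submodule

variable {V : Type*} [AddCommGroup V] [Module ℂ V]

/-- `(B, C)` is a well-balanced pair : `B` and `C` are disjoint finite sets of
nonzero vectors, `B` is a basis of `V`, `C` is linearly independent of cardinality
`dim V - 1`, and no element of `B` lies in `span C`. -/
def IsWellBalancedPair [DecidableEq V] (B C : Finset V) : Prop :=
  Disjoint B C ∧ (0 : V) ∉ B ∪ C ∧
    LinIndepF B ∧ span ℂ (B : Set V) = ⊤ ∧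
    LinIndepF C ∧ C.card = finrank ℂ V - 1 ∧
    ∀ b ∈ B, b ∉ span ℂ (C : Set V)

/-- A subset of a linearly independent set spans a space of dimension its cardinality. -/
theorem LinIndepF.finrank_span_eq_card_of_subset {T U : Finset V} (hT : LinIndepF T)
    (hUT : U ⊆ T) : finrank ℂ (span ℂ (U : Set V)) = U.card := by
  have hT' : LinearIndepOn ℂ id (T : Set V) := hT
  exact finrank_span_finset_eq_card (hT'.mono (Finset.coe_subset.2 hUT))

/-- The part of a set `D` lying in a linearly independent set has at most `dim (span D)`
elements. -/
theorem LinIndepF.card_inter_le_finrank_span [DecidableEq V] {T : Finset V} (hT : LinIndepF T)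
    (D : Finset V) : (D ∩ T).card ≤ finrank ℂ (span ℂ (D : Set V)) := by
  rw [← hT.finrank_span_eq_card_of_subset Finset.inter_subset_right]
  exact Submodule.finrank_mono (span_mono (by simp))

/-- If `D` contains a vector outside the span of the linearly independent set `T`, then the part
of `D` lying in `T` has fewer than `dim (span D)` elements. -/
theorem LinIndepF.card_inter_lt_finrank_span [DecidableEq V] {T : Finset V} (hT : LinIndepF T)
    {D : Finset V} {b : V} (hbD : b ∈ D) (hbT : b ∉ span ℂ (T : Set V)) :
    (D ∩ T).card < finrank ℂ (span ℂ (D : Set V)) := by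
  rw [← hT.finrank_span_eq_card_of_subset Finset.inter_subset_right]
  refine Submodule.finrank_lt_finrank_of_lt
    (SetLike.lt_iff_le_and_exists.2 ⟨span_mono (by simp), b, subset_span hbD, fun hb => hbT ?_⟩)
  exact span_mono (by simp) hb

/-- If `(B, C)` is a well-balanced pair then every nonempty subset
`D ⊆ B ∪ C` satisfies `|D| < 2 · dim (span D)`; in particular `B ∪ C` is balanced. -/
theorem wellBalancedPair_union_isBalanced [DecidableEq V] [FiniteDimensional ℂ V]
    (B C : Finset V) (h : IsWellBalancedPair B C) :
    (∀ D : Finset V, D ⊆ B ∪ C → D.Nonempty →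
        D.card < 2 * finrank ℂ (span ℂ (D : Set V))) ∧
      IsBalanced (B ∪ C) := by
  obtain ⟨-, -, hB, hspan, hC, -, hBC⟩ := h
  have key : ∀ D : Finset V, D ⊆ B ∪ C → D.Nonempty →
      D.card < 2 * finrank ℂ (span ℂ (D : Set V)) := by
    intro D hD hne
    have hcard : D.card ≤ (D ∩ B).card + (D ∩ C).card := by
      calc D.card = ((D ∩ B) ∪ (D ∩ C)).card := by
            rw [← Finset.inter_union_distrib_left, Finset.inter_eq_left.2 hD]
        _ ≤ _ := Finset.card_union_le _ _
    have hDB := hB.card_inter_le_finrank_span D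
    rcases (D ∩ B).eq_empty_or_nonempty with hempty | ⟨b, hb⟩
    · have hDC := hC.card_inter_le_finrank_span D
      have hpos := hne.card_pos
      rw [hempty, Finset.card_empty] at hcard
      omega
    · obtain ⟨hbD, hbB⟩ := Finset.mem_inter.1 hb
      have hDC := hC.card_inter_lt_finrank_span hbD (hBC b hbB)
      omega
  refine ⟨key, ?_, fun S' hS' => key S' hS'.1⟩
  rw [eq_top_iff, ← hspan]
  exact span_mono (by simp)
end

section
/- Let A be a finite set of nonzero vectors spanning V, with dim V = r. Suppose there exists a subset F ⊆ A with F = A ∩ span(F) and dim(span F) = r − 1, such that there is no subset G ⊆ A with G = A ∩ span(G), span(G) ≠ V, and A = F ∪ G. Then there exists a well-balanced pair (B, C) with B ⊆ A ∖ F and C ⊆ F. -/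
open Module Submodule

variable {V : Type*} [AddCommGroup V] [Module ℂ V]

/-- Every finite set of vectors contains a linearly independent subset with the same span. -/
theorem exists_subset_linIndepF_span_eq (T : Finset V) :
    ∃ S ⊆ T, LinIndepF S ∧ span ℂ (S : Set V) = span ℂ (T : Set V) := by
  obtain ⟨b, hbT, hb, hli⟩ := exists_linearIndependent ℂ (T : Set V)
  lift b to Finset V using T.finite_toSet.subset hbT
  exact ⟨b, by exact_mod_cast hbT, hli, hb⟩

/-- If the finite set `A` is not the union of `F` and a closed subset of `A` with proper span,
then `A \ F` spans the whole space. -/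
theorem span_sdiff_eq_top_of_not_exists_isClosedIn [DecidableEq V] {A F : Finset V} (hFA : F ⊆ A)
    (hno : ¬ ∃ G : Finset V, IsClosedIn A G ∧ span ℂ (G : Set V) ≠ ⊤ ∧ A = F ∪ G) :
    span ℂ ((A \ F : Finset V) : Set V) = ⊤ := by
  classical
  by_contra hne
  let G := A.filter (· ∈ span ℂ ((A \ F : Finset V) : Set V))
  have hG : span ℂ (G : Set V) ≤ span ℂ ((A \ F : Finset V) : Set V) :=
    span_le.2 fun v hv => (Finset.mem_filter.1 hv).2
  refine hno ⟨G, ⟨Finset.filter_subset _ _, fun v hv hvG => Finset.mem_filter.2 ⟨hv, hG hvG⟩⟩,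
    fun h => hne (top_le_iff.1 (h ▸ hG)), Finset.Subset.antisymm (fun v hv => ?_)
      (Finset.union_subset hFA (Finset.filter_subset _ _))⟩
  by_cases hvF : v ∈ F
  · exact Finset.mem_union_left _ hvF
  · exact Finset.mem_union_right _ <| Finset.mem_filter.2
      ⟨hv, subset_span (Finset.mem_coe.2 (Finset.mem_sdiff.2 ⟨hv, hvF⟩))⟩

/-- Let `A` be a finite set of nonzero vectors spanning `V`, with
`dim V = r`.  Suppose there is a closed subset `F ⊆ A` (i.e. `F = A ∩ span F`) with
`dim (span F) = r - 1` such that there is no closed subset `G ⊆ A` with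
`span G ≠ V` and `A = F ∪ G`.  Then there is a well-balanced pair `(B, C)` with
`B ⊆ A \ F` and `C ⊆ F`. -/
theorem wellBalanced_lattice_exists_wellBalancedPair [DecidableEq V]
    [FiniteDimensional ℂ V] (A : Finset V) (h0 : (0 : V) ∉ A)
    (hspan : span ℂ (A : Set V) = ⊤)
    (F : Finset V) (hF : IsClosedIn A F)
    (hFrk : finrank ℂ (span ℂ (F : Set V)) = finrank ℂ V - 1)
    (hno : ¬ ∃ G : Finset V, IsClosedIn A G ∧ span ℂ (G : Set V) ≠ ⊤ ∧ A = F ∪ G) :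
    ∃ B C : Finset V, B ⊆ A \ F ∧ C ⊆ F ∧ IsWellBalancedPair B C := by
  obtain ⟨B, hBA, hB, hBspan⟩ := exists_subset_linIndepF_span_eq (A \ F)
  obtain ⟨C, hCF, hC, hCspan⟩ := exists_subset_linIndepF_span_eq F
  refine ⟨B, C, hBA, hCF, Finset.disjoint_of_subset_left hBA
    (Finset.disjoint_of_subset_right hCF Finset.sdiff_disjoint), ?_, hB,
    hBspan.trans (span_sdiff_eq_top_of_not_exists_isClosedIn hF.1 hno), hC, ?_, ?_⟩
  · exact fun h => h0 <| Finset.union_subset (hBA.trans Finset.sdiff_subset) (hCF.trans hF.1) h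
  · rw [← hFrk, ← hCspan]
    exact (finrank_span_finset_eq_card hC).symm
  · intro b hb hbC
    obtain ⟨hbA, hbF⟩ := Finset.mem_sdiff.1 (hBA hb)
    exact hbF (hF.2 b hbA (hCspan ▸ hbC))
end

section
/- Let A be a finite set of nonzero vectors spanning V, with dim V = r ≥ 2, and let n = |A|. Suppose that every nonempty subset G ⊆ A with G = A ∩ span(G) and span(G) ≠ V satisfies 2·|G| < n. Then A contains a well-balanced pair, i.e., there exist disjoint subsets B, C ⊆ A such that B is a basis of V, C is linearly independent with |C| = r − 1, and no element of B lies in span(C); in particular the arrangement A is large. -/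
open Module Submodule

variable {V : Type*} [AddCommGroup V] [Module ℂ V]

/-- Every finite spanning set contains a basis. -/
theorem exists_linIndepF_subset_span_eq_top (S : Finset V) (hS : span ℂ (S : Set V) = ⊤) :
    ∃ B ⊆ S, LinIndepF B ∧ span ℂ (B : Set V) = ⊤ := by
  obtain ⟨b, hbS, hb, hli⟩ := exists_linearIndependent ℂ (S : Set V)
  lift b to Finset V using S.finite_toSet.subset hbS
  exact ⟨b, mod_cast hbS, hli, hb.trans hS⟩

theorem LinIndepF.mono {S T : Finset V} (hT : LinIndepF T) (h : S ⊆ T) : LinIndepF S :=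
  LinearIndepOn.mono (s := (T : Set V)) (t := (S : Set V)) (v := id) hT (mod_cast h)

theorem LinIndepF.finrank_span {S : Finset V} (hS : LinIndepF S) :
    finrank ℂ (span ℂ (S : Set V)) = S.card :=
  finrank_span_finset_eq_card hS

/-- Let `A` be a finite set of nonzero vectors spanning `V`, with
`dim V = r ≥ 2` and `n = |A|`.  If every nonempty closed subset `G ⊆ A`
(`G = A ∩ span G`) with `span G ≠ V` satisfies `2 · |G| < n`, then `A` contains a
well-balanced pair; in particular the arrangement `A` is large. -/
theorem small_flats_exists_wellBalancedPair [DecidableEq V]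
    [FiniteDimensional ℂ V] (A : Finset V) (h0 : (0 : V) ∉ A)
    (hspan : span ℂ (A : Set V) = ⊤) (hr : 2 ≤ finrank ℂ V)
    (hsmall : ∀ G : Finset V, G ⊆ A → G.Nonempty →
      (∀ v ∈ A, v ∈ span ℂ (G : Set V) → v ∈ G) →
      span ℂ (G : Set V) ≠ ⊤ → 2 * G.card < A.card) :
    ∃ B C : Finset V, B ⊆ A ∧ C ⊆ A ∧ IsWellBalancedPair B C := by
  -- If every proper flat is small, every proper subspace contains less than half of `A`.
  have hlt (W : Submodule ℂ V) (hW : W ≠ ⊤) (S : Finset V) (hSA : S ⊆ A)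
      (hne : S.Nonempty) (hS : (S : Set V) ⊆ W) : 2 * S.card < A.card := by
    classical
    set G := A.filter (· ∈ W)
    have hGW : span ℂ (G : Set V) ≤ W := span_le.2 fun v hv => (Finset.mem_filter.1 hv).2
    have hSG : S ⊆ G := fun v hv => Finset.mem_filter.2 ⟨hSA hv, hS hv⟩
    have := hsmall G (Finset.filter_subset _ _) (hne.mono hSG)
      (fun v hv hvG => Finset.mem_filter.2 ⟨hv, hGW hvG⟩)
      (fun h => hW (top_le_iff.1 (h ▸ hGW)))
    have := Finset.card_le_card hSG
    lia
  classical
  obtain ⟨D, hDA, hD, hDtop⟩ := exists_linIndepF_subset_span_eq_top A hspan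
  have hDcard : D.card = finrank ℂ V := by
    rw [← hD.finrank_span, hDtop, finrank_top]
  obtain ⟨C, hCD, hCcard⟩ := Finset.exists_subset_card_eq (s := D) (n := finrank ℂ V - 1) (by lia)
  have hC : LinIndepF C := hD.mono hCD
  have hCtop : span ℂ (C : Set V) ≠ ⊤ := fun h => by
    have := hC.finrank_span
    rw [h, finrank_top] at this
    lia
  have hCne : C.Nonempty := Finset.card_pos.1 (by lia)
  set G := A.filter (· ∈ span ℂ (C : Set V))
  set S := A.filter (· ∉ span ℂ (C : Set V))
  have hCG : C ⊆ G := fun v hv => Finset.mem_filter.2 ⟨hDA (hCD hv), subset_span hv⟩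
  have hGcard := hlt _ hCtop G (Finset.filter_subset _ _) (hCne.mono hCG)
    fun v hv => (Finset.mem_filter.1 hv).2
  have hadd : G.card + S.card = A.card := Finset.card_filter_add_card_filter_not _
  have hStop : span ℂ (S : Set V) = ⊤ := by
    by_contra h
    have := hlt _ h S (Finset.filter_subset _ _) (Finset.card_pos.1 (by lia)) subset_span
    lia
  obtain ⟨B, hBS, hB, hBtop⟩ := exists_linIndepF_subset_span_eq_top S hStop
  have hBA : B ⊆ A := hBS.trans (Finset.filter_subset _ _)
  have hCA : C ⊆ A := hCD.trans hDA
  have hBC : ∀ b ∈ B, b ∉ span ℂ (C : Set V) := fun b hb => (Finset.mem_filter.1 (hBS hb)).2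
  exact ⟨B, C, hBA, hCA, Finset.disjoint_left.2 fun v hvB hvC => hBC v hvB (subset_span hvC),
    fun h => h0 (Finset.union_subset hBA hCA h), hB, hBtop, hC, hCcard, hBC⟩
end

section
/- Let r ≥ 3, m ≥ 2, and let ζ ∈ ℂ be a primitive m-th root of unity. In the dual space of ℂ^r with coordinate functionals x_1, …, x_r, consider the special monomial reflection arrangement A of G(m,m,r) consisting of the forms x_i − ζ^k x_j (1 ≤ i < j ≤ r, 0 ≤ k < m). Let B = {x_1 − ζx_2, …, x_1 − ζx_r, x_2 − ζx_3} and C = {x_1 − x_2, …, x_1 − x_r}. Then B ∪ C ⊆ A, B ∩ C = ∅, B is a basis of the dual space, C is linearly independent with |C| = r − 1, C lies in the kernel of the index functional ind(Σ a_i x_i) = Σ a_i while no element of B lies in this kernel, and consequently no element of B lies in span(C); i.e., (B, C) is a well-balanced pair for A. -/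
/-!
**Statement 7.** Let `r ≥ 3`, `m ≥ 2`, and let `ζ` be a primitive `m`-th root of
unity.  In the dual space of `ℂ^r` with coordinate functionals `x 0, …, x (r-1)`,
the special monomial reflection arrangement `A` of `G(m,m,r)` consists of the
forms `x i - ζ^k • x j` (`i < j`, `0 ≤ k < m`).  Let
`B = {x 0 - ζ•x 1, …, x 0 - ζ•x (r-1), x 1 - ζ•x 2}` and
`C = {x 0 - x j : j ≠ 0}`.  Then `B ∪ C ⊆ A`, `B ∩ C = ∅`, `B` is a basis of the
dual space, `C` is linearly independent with `|C| = r - 1`, `C` lies in the kernel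
of the index functional `ind` (the linear functional with `ind (x i) = 1`) while no
element of `B` does, and consequently no element of `B` lies in `span C`; i.e.
`(B, C)` is a well-balanced pair for `A`.
-/

open Module Submodule

/-- The differences of one vector with the other members of a linearly independent family are
linearly independent. -/
theorem LinearIndependent.sub_left_ne {K V ι : Type*} [Field K] [AddCommGroup V] [Module K V]
    {v : ι → V} (hv : LinearIndependent K v) (i : ι) :
    LinearIndependent K (fun j : {j // j ≠ i} => v i - v j) := by
  have h := (affineIndependent_iff_linearIndependent_vsub K v i).1 hv.affineIndependent
  have h' := h.units_smul (fun _ => (-1 : Kˣ))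
  have heq : (fun j : {j // j ≠ i} => v i - v j) =
      (fun _ : {j // j ≠ i} => (-1 : Kˣ)) • fun j : {j // j ≠ i} => v j -ᵥ v i := by
    funext j
    simp [Units.smul_def]
  exact heq ▸ h'

/-- A submodule containing `u - ζ • v j` for all `j` and `v a - ζ • v b`, where `ζ ≠ 0, 1`,
contains all of the vectors involved. -/
theorem Submodule.mem_of_sub_smul_mem {K V ι : Type*} [Field K] [AddCommGroup V] [Module K V]
    {S : Submodule K V} {ζ : K} (h0 : ζ ≠ 0) (h1 : ζ ≠ 1) {u : V} {v : ι → V}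
    (hu : ∀ j, u - ζ • v j ∈ S) {a b : ι} (hab : v a - ζ • v b ∈ S) :
    u ∈ S ∧ ∀ j, v j ∈ S := by
  have hmem : u ∈ S := by
    have ha : (1 - ζ) • v a ∈ S := by
      have := S.sub_mem hab (S.sub_mem (hu b) (hu a))
      convert this using 1
      module
    have ha' : v a ∈ S := (S.smul_mem_iff (sub_ne_zero.2 h1.symm)).1 ha
    simpa using S.add_mem (hu a) (S.smul_mem ζ ha')
  refine ⟨hmem, fun j => (S.smul_mem_iff h0).1 ?_⟩
  simpa using S.sub_mem hmem (hu j)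

theorem specialMonomial_wellBalancedPair (r m : ℕ) (hr : 3 ≤ r) (hm : 2 ≤ m)
    (ζ : ℂ) (hζ : IsPrimitiveRoot ζ m)
    (x : Fin r → Module.Dual ℂ (Fin r → ℂ))
    (hx : ∀ i, x i = LinearMap.proj i)
    (ind : Module.Dual ℂ (Fin r → ℂ) →ₗ[ℂ] ℂ)
    (hind : ∀ i, ind (x i) = 1)
    (A B C : Set (Module.Dual ℂ (Fin r → ℂ)))
    (hA : A = {f | ∃ i j : Fin r, ∃ k : ℕ, i < j ∧ k < m ∧ f = x i - ζ ^ k • x j})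
    (hB : B = {f | (∃ j : Fin r, j ≠ ⟨0, by omega⟩ ∧ f = x ⟨0, by omega⟩ - ζ • x j) ∨
        f = x ⟨1, by omega⟩ - ζ • x ⟨2, by omega⟩})
    (hC : C = {f | ∃ j : Fin r, j ≠ ⟨0, by omega⟩ ∧ f = x ⟨0, by omega⟩ - x j}) :
    B ∪ C ⊆ A ∧ Disjoint B C ∧
      LinearIndependent ℂ (fun b : B => (b : Module.Dual ℂ (Fin r → ℂ))) ∧
      span ℂ B = ⊤ ∧
      LinearIndependent ℂ (fun c : C => (c : Module.Dual ℂ (Fin r → ℂ))) ∧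
      C.ncard = r - 1 ∧
      (∀ f ∈ C, ind f = 0) ∧
      (∀ b ∈ B, ind b ≠ 0) ∧
      ∀ b ∈ B, b ∉ span ℂ C := by
  have h0 : ζ ≠ 0 := hζ.ne_zero (by omega)
  have h1 : ζ ≠ 1 := hζ.ne_one (by omega)
  have hxB : x = (Pi.basisFun ℂ (Fin r)).dualBasis := by
    funext i
    rw [hx]
    ext j
    simp [Pi.single_apply]
  have hxli : LinearIndependent ℂ x := hxB ▸ Basis.linearIndependent _
  have hxspan : span ℂ (Set.range x) = ⊤ := hxB ▸ Basis.span_eq _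
  let z : Fin r := ⟨0, by omega⟩
  have hpos : ∀ j : Fin r, j ≠ z → z < j := fun j hj =>
    Fin.lt_def.2 (Nat.pos_of_ne_zero fun h => hj (Fin.ext h))
  have hone : (⟨1, by omega⟩ : Fin r) ≠ z := by simp [z, Fin.ext_iff]
  have htwo : (⟨2, by omega⟩ : Fin r) ≠ z := by simp [z, Fin.ext_iff]
  have hspanB : span ℂ B = ⊤ := by
    obtain ⟨hu, hv⟩ := Submodule.mem_of_sub_smul_mem (S := span ℂ B) h0 h1 (u := x z)
      (v := fun j : {j // j ≠ z} => x j)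
      (fun j => subset_span (hB ▸ Or.inl ⟨j, j.2, rfl⟩))
      (a := ⟨_, hone⟩) (b := ⟨_, htwo⟩) (subset_span (hB ▸ Or.inr rfl))
    rw [eq_top_iff, ← hxspan, span_le]
    rintro _ ⟨j, rfl⟩
    by_cases hj : j = z
    · exact hj ▸ hu
    · exact hv ⟨j, hj⟩
  have hrangeB : B = Set.range fun j : Fin r =>
      if j = z then x ⟨1, by omega⟩ - ζ • x ⟨2, by omega⟩ else x z - ζ • x j := by
    rw [hB]
    ext f
    constructor
    · rintro (⟨j, hj, rfl⟩ | rfl)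
      · exact ⟨j, if_neg hj⟩
      · exact ⟨z, if_pos rfl⟩
    · rintro ⟨j, rfl⟩
      by_cases hj : j = z
      · exact Or.inr (if_pos hj)
      · exact Or.inl ⟨j, hj, if_neg hj⟩
  have hliB : LinearIndependent ℂ (fun b : B => (b : Module.Dual ℂ (Fin r → ℂ))) := by
    rw [hrangeB] at hspanB ⊢
    exact (linearIndependent_of_top_le_span_of_card_eq_finrank hspanB.ge
      (by simp [Subspace.dual_finrank_eq])).linearIndepOn_id
  have hrangeC : C = Set.range fun j : {j // j ≠ z} => x z - x j := by
    rw [hC]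
    ext f
    constructor
    · rintro ⟨j, hj, rfl⟩
      exact ⟨⟨j, hj⟩, rfl⟩
    · rintro ⟨j, rfl⟩
      exact ⟨j, j.2, rfl⟩
  have hliC := hxli.sub_left_ne z
  have hcardC : C.ncard = r - 1 := by
    rw [hrangeC, ← Set.image_univ, Set.ncard_image_of_injective _ hliC.injective, Set.ncard_univ,
      Nat.card_eq_fintype_card]
    simp
  have hindC : ∀ f ∈ C, ind f = 0 := by
    rw [hC]
    rintro _ ⟨j, -, rfl⟩
    simp [hind]
  have hindB : ∀ b ∈ B, ind b ≠ 0 := by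
    rw [hB]
    rintro _ (⟨j, -, rfl⟩ | rfl) <;> simpa [hind, sub_eq_zero] using h1.symm
  have hspanC : span ℂ C ≤ LinearMap.ker ind := span_le.2 hindC
  refine ⟨?_, Set.disjoint_left.2 fun f hfB hfC => hindB f hfB (hindC f hfC), hliB, hspanB,
    hrangeC ▸ hliC.linearIndepOn_id, hcardC, hindC, hindB,
    fun b hb hbC => hindB b hb (hspanC hbC)⟩
  rw [hA, hB, hC]
  rintro _ ((⟨j, hj, rfl⟩ | rfl) | ⟨j, hj, rfl⟩)
  · exact ⟨z, j, 1, hpos j hj, by omega, by rw [pow_one]⟩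
  · exact ⟨_, _, 1, Fin.mk_lt_mk.2 one_lt_two, by omega, by rw [pow_one]⟩
  · exact ⟨z, j, 0, hpos j hj, by omega, by rw [pow_zero, one_smul]⟩
end

section
/- Let S be a balanced finite set of nonzero vectors of V with dim V = r, let B ⊆ S be a basis of V, and set C = S ∖ B with |C| = s ≥ 1. Then at least r − s + 1 elements of B do not lie in span(C), i.e., |{b ∈ B : b ∉ span(C)}| ≥ r − s + 1. -/
open Module Submodule

variable {V : Type*} [AddCommGroup V] [Module ℂ V]

/-- Let `S` be a balanced finite set of nonzero vectors of `V`
with `dim V = r`, let `B ⊆ S` be a basis of `V`, and set `C = S \ B` with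
`|C| = s ≥ 1`.  Then at least `r - s + 1` elements of `B` do not lie in `span C`. -/
theorem balanced_card_not_mem_span_compl [DecidableEq V] [FiniteDimensional ℂ V]
    (S B : Finset V) (h0 : (0 : V) ∉ S) (hS : IsBalanced S)
    (hBS : B ⊆ S) (hBi : LinIndepF B) (hBs : span ℂ (B : Set V) = ⊤)
    (s : ℕ) (hs : (S \ B).card = s) (hs1 : 1 ≤ s) :
    finrank ℂ V - s + 1 ≤
      {b ∈ (B : Set V) | b ∉ span ℂ ((S \ B : Finset V) : Set V)}.ncard := by
  classical
  have hB : B.card = finrank ℂ V := by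
    rw [← finrank_top, ← hBs, finrank_span_finset_eq_card hBi]
  have hSc : S.card = finrank ℂ V + s := by
    rw [← hB, ← hs, Finset.card_sdiff_of_subset hBS]
    have := Finset.card_le_card hBS
    omega
  have hSne : S.Nonempty := Finset.card_pos.mp (by omega)
  have hsr := hS.2 S ⟨subset_rfl, fun v hv _ => hv⟩ hSne
  rw [hS.1, finrank_top] at hsr
  set W := span ℂ ((S \ B : Finset V) : Set V)
  have hCsub : S \ B ⊆ S.filter (· ∈ W) := fun v hv =>
    Finset.mem_filter.mpr ⟨(Finset.mem_sdiff.mp hv).1, subset_span hv⟩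
  have hspan : span ℂ ((S.filter (· ∈ W) : Finset V) : Set V) = W := by
    apply le_antisymm
    · exact span_le.mpr fun v hv => (Finset.mem_filter.mp hv).2
    · exact span_mono (Finset.coe_subset.mpr hCsub)
  have hbal := hS.2 (S.filter (· ∈ W))
    ⟨Finset.filter_subset _ _, fun v hv hvW =>
      Finset.mem_filter.mpr ⟨hv, hspan ▸ hvW⟩⟩
    ((Finset.card_pos.mp (by omega)).mono hCsub)
  rw [hspan] at hbal
  have hdim : finrank ℂ W ≤ s := hs ▸ finrank_span_finset_le_card (S \ B)
  have hunion : S.filter (· ∈ W) = (S \ B) ∪ B.filter (· ∈ W) := by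
    ext v
    have hv : v ∈ S \ B → v ∈ W := fun h => subset_span h
    have hvS : v ∈ B → v ∈ S := fun h => hBS h
    simp only [Finset.mem_filter, Finset.mem_union, Finset.mem_sdiff] at hv ⊢
    tauto
  have hdisj : Disjoint (S \ B) (B.filter (· ∈ W)) :=
    Finset.sdiff_disjoint.mono_right (Finset.filter_subset _ _)
  rw [hunion, Finset.card_union_of_disjoint hdisj, hs] at hbal
  have hsplit := Finset.card_filter_add_card_filter_not (s := B) (· ∈ W)
  have hset : {b ∈ (B : Set V) | b ∉ W} = ((B.filter (· ∉ W) : Finset V) : Set V) := by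
    ext v
    simp
  rw [hset, Set.ncard_coe_finset]
  omega
end
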